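/- Assume there exists a Fourier summing net for Σ that preserves the invariant ideals of A. Then for a closed two-sided ideal 𝒥 of C*_r(Σ) the following are equivalent: (a) 𝒥 is E-invariant; (b) 𝒥 is δ_Σ-invariant; (c) 𝒥 is induced, i.e. 𝒥 = ⟨J⟩ for some α-invariant ideal J of A. Consequently, the map J ↦ ⟨J⟩ is a bijection between the set of α-invariant closed two-sided ideals of A and the set of E-invariant ideals of C*_r(Σ). -/

import Mathlib

open scoped ComplexOrder

noncomputable section

namespace BCFourier

/-- A twisted (unital, discrete) C*-dynamical system `Σ = (A, G, α, σ)`. -/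
structure TwistedSystem (A : Type*) (G : Type*) [CStarAlgebra A] [Group G] where
  α : G → (A ≃⋆ₐ[ℂ] A)
  σ : G → G → A
  σ_unitary : ∀ g h, σ g h ∈ unitary A
  alpha_mul : ∀ g h a, α g (α h a) = σ g h * α (g * h) a * star (σ g h)
  sigma_cocycle : ∀ g h k, σ g h * σ (g * h) k = α g (σ h k) * σ g (h * k)
  sigma_one_left : ∀ g, σ 1 g = 1
  sigma_one_right : ∀ g, σ g 1 = 1

variable {A G B : Type*} [CStarAlgebra A] [Group G] [CStarAlgebra B]

/-- Membership in the Hilbert `A`-module `A^Σ`:  unconditional norm convergence of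
`∑_g α_g⁻¹(ξ(g)* ξ(g))`. -/
def MemAS (S : TwistedSystem A G) (ξ : G → A) : Prop :=
  Summable fun g => (S.α g).symm (star (ξ g) * ξ g)

/-- The `A`-valued inner product `⟨ξ, η⟩_α = ∑_g α_g⁻¹(ξ(g)* η(g))` on `A^Σ`. -/
def innerAS (S : TwistedSystem A G) (ξ η : G → A) : A :=
  ∑' g, (S.α g).symm (star (ξ g) * η g)

/-- The norm `‖ξ‖_α = ‖⟨ξ,ξ⟩_α‖^{1/2}` on `A^Σ`. -/
def normAS (S : TwistedSystem A G) (ξ : G → A) : ℝ :=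
  Real.sqrt ‖innerAS S ξ ξ‖

/-- Abstract characterization of the reduced twisted crossed product `C*_r(Σ)`:
a C*-algebra `B` together with a copy `ι` of `A`, unitaries `u g` implementing the
twisted action, and the canonical faithful conditional expectation `E`, such that
the Fourier coefficients `x̂(g) = E(x u_g*)` lie in `A^Σ`, `E(x* x) = ⟨x̂, x̂⟩_α`,
and `B` is topologically generated by the elements `ι(a) u g`. -/
structure CrossedProduct {A G : Type*} [CStarAlgebra A] [Group G]
    (S : TwistedSystem A G) (B : Type*) [CStarAlgebra B] where
  ι : A →⋆ₐ[ℂ] B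
  ι_isometric : ∀ a, ‖ι a‖ = ‖a‖
  u : G → B
  u_unitary : ∀ g, u g ∈ unitary B
  u_one : u 1 = 1
  covariance : ∀ g a, u g * ι a = ι (S.α g a) * u g
  u_mul : ∀ g h, u g * u h = ι (S.σ g h) * u (g * h)
  E : B →L[ℂ] A
  E_iota : ∀ a, E (ι a) = a
  E_perp : ∀ a g, g ≠ 1 → E (ι a * u g) = 0
  E_contractive : ∀ x, ‖E x‖ ≤ ‖x‖
  E_faithful : ∀ x, E (star x * x) = 0 → x = 0
  hat_mem : ∀ x : B, MemAS S fun g => E (x * star (u g))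
  E_inner : ∀ x : B,
    E (star x * x) = innerAS S (fun g => E (x * star (u g))) fun g => E (x * star (u g))
  generated : Dense (↑(Submodule.span ℂ {b : B | ∃ a g, b = ι a * u g}) : Set B)

variable {S : TwistedSystem A G}

/-- The Fourier transform `x̂ : G → A` of `x ∈ C*_r(Σ)`. -/
def hatF (D : CrossedProduct S B) (x : B) : G → A := fun g => D.E (x * star (D.u g))

/-- The norm `‖x‖_α = ‖x̂‖_α = ‖E(x* x)‖^{1/2}` on `C*_r(Σ)`. -/
def alphaNorm (D : CrossedProduct S B) (x : B) : ℝ := Real.sqrt ‖D.E (star x * x)‖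

/-- `Λ_Σ(f) = ∑_g f(g) λ_Σ(g)` for finitely supported `f : G → A`. -/
def Lam (D : CrossedProduct S B) (f : G → A) : B := ∑ᶠ g, D.ι (f g) * D.u g

/-- `CF(Σ)`: the set of `x ∈ C*_r(Σ)` whose Fourier series `∑_g x̂(g) λ_Σ(g)`
converges unconditionally in the operator norm. -/
def CFmem (D : CrossedProduct S B) (x : B) : Prop :=
  ∃ y : B, HasSum (fun g => D.ι (hatF D x g) * D.u g) y

/-- `M : C*_r(Σ) → C*_r(Σ)` is the bounded map associated with the (reduced)
multiplier `T : G × A → A`, i.e. `T ∈ MA(Σ)` with `M_T = M`. -/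
def IsMultiplier (D : CrossedProduct S B) (T : G → A → A) (M : B →L[ℂ] B) : Prop :=
  (∀ g, IsLinearMap ℂ (T g)) ∧ ∀ g a, M (D.ι a * D.u g) = D.ι (T g a) * D.u g

/-- The norm of a column vector in the Hilbert `B`-module `Bⁿ`. -/
def vecNorm {n : ℕ} (x : Fin n → B) : ℝ := Real.sqrt ‖∑ i, star (x i) * x i‖

/-- The C*-norm on `Mₙ(B)`, realized as the operator norm for the action of
matrices on the Hilbert `B`-module `Bⁿ`. -/
def matNorm {n : ℕ} (m : Matrix (Fin n) (Fin n) B) : ℝ :=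
  sInf {M : ℝ | 0 ≤ M ∧ ∀ x : Fin n → B, vecNorm (m.mulVec x) ≤ M * vecNorm x}

/-- `φ : B → B` is completely bounded with cb-norm at most `M`. -/
def CBBoundedBy (φ : B → B) (M : ℝ) : Prop :=
  0 ≤ M ∧ ∀ (n : ℕ) (m : Matrix (Fin n) (Fin n) B), matNorm (m.map φ) ≤ M * matNorm m

/-- The completely bounded norm `‖φ‖_cb`. -/
def cbNorm (φ : B → B) : ℝ := sInf {M : ℝ | CBBoundedBy φ M}

/-- `φ : B → B` is completely bounded. -/
def IsCompletelyBounded (φ : B → B) : Prop := ∃ M, CBBoundedBy φ M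

/-- `φ : B → B` is completely positive. -/
def IsCompletelyPositive [PartialOrder B] [StarOrderedRing B] (φ : B → B) : Prop :=
  ∀ (n : ℕ) (b c : Fin n → B), 0 ≤ ∑ i, ∑ j, star (c i) * φ (star (b i) * b j) * c j

/-- `ξ` tends to `0` at infinity w.r.t. the norm `N`. -/
def TendsZeroAtInfty (N : (G → A) → ℝ) (ξ : G → A) : Prop :=
  ∀ ε : ℝ, 0 < ε → ∃ F₀ : Finset G, ∀ F : Finset G, Disjoint F F₀ →
    N (Set.indicator (↑F : Set G) ξ) < ε

/-- The (closed, two-sided) ideal of `C*_r(Σ)` induced by a subset `J` of `A`. -/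
def genIdeal (D : CrossedProduct S B) (J : Set A) : Set B :=
  closure ↑(Submodule.span ℂ {z : B | ∃ x y : B, ∃ j ∈ J, z = x * D.ι j * y})

/-- `J` is an `α`-invariant closed two-sided ideal of `A`. -/
def IsInvIdeal (S : TwistedSystem A G) (J : Set A) : Prop :=
  IsClosed J ∧ (0 : A) ∈ J ∧ (∀ a b, a ∈ J → b ∈ J → a + b ∈ J) ∧
    (∀ a ∈ J, ∀ b : A, b * a ∈ J ∧ a * b ∈ J) ∧ ∀ g, ∀ a ∈ J, S.α g a ∈ J

/-- A closed two-sided ideal of a C*-algebra, as a set. -/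
def IsClosedIdeal {B : Type*} [CStarAlgebra B] (I : Set B) : Prop :=
  IsClosed I ∧ (0 : B) ∈ I ∧ (∀ x y, x ∈ I → y ∈ I → x + y ∈ I) ∧
    ∀ x ∈ I, ∀ b : B, b * x ∈ I ∧ x * b ∈ I

/-- An ideal `I` of `C*_r(Σ)` is `E`-invariant when `E(I) ⊆ I`. -/
def EInv (D : CrossedProduct S B) (I : Set B) : Prop := ∀ x ∈ I, D.ι (D.E x) ∈ I

/-- A Fourier summing net for `Σ`: a net `{Tⁱ}` in `MCF(Σ)` such that
`M_{Tⁱ}(x) → x` in norm for every `x ∈ C*_r(Σ)`. -/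
structure FSNet {A G : Type*} [CStarAlgebra A] [Group G] {S : TwistedSystem A G}
    {B : Type*} [CStarAlgebra B] (D : CrossedProduct S B) where
  Idx : Type
  pre : Preorder Idx
  dir : IsDirected Idx fun a b => pre.le a b
  nonempty : Nonempty Idx
  T : Idx → G → A → A
  T_lin : ∀ i g, IsLinearMap ℂ (T i g)
  M : Idx → B →L[ℂ] B
  M_mult : ∀ i g a, M i (D.ι a * D.u g) = D.ι (T i g a) * D.u g
  M_cf : ∀ i x, CFmem D (M i x)
  M_lim : ∀ x : B, Filter.Tendsto (fun i => ‖M i x - x‖) (@Filter.atTop Idx pre) (nhds 0)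

/-- `Σ` has the bounded Fejér property: there is a bounded Fourier summing net for `Σ`
consisting of multipliers with finite `G`-support. -/
def HasBoundedFejer (D : CrossedProduct S B) : Prop :=
  ∃ net : FSNet D, (∃ C : ℝ, ∀ i, ‖net.M i‖ ≤ C) ∧ ∀ i, {g | ∃ a, net.T i g a ≠ 0}.Finite


/-- A (right) Hilbert `A`-module structure on `X`: right `A`-action `smulA`,
`A`-valued inner product (linear in the second variable), with
`‖x‖ = ‖⟨x,x⟩‖^{1/2}`. -/
structure HilbMod (A : Type*) [CStarAlgebra A] [PartialOrder A] [StarOrderedRing A]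
    (X : Type*) [NormedAddCommGroup X] [NormedSpace ℂ X] where
  smulA : X → A → X
  inner : X → X → A
  smulA_add : ∀ x a b, smulA x (a + b) = smulA x a + smulA x b
  add_smulA : ∀ x y a, smulA (x + y) a = smulA x a + smulA y a
  smulA_mul : ∀ x a b, smulA x (a * b) = smulA (smulA x a) b
  smulA_one : ∀ x, smulA x 1 = x
  smulA_smul : ∀ (c : ℂ) x a, smulA (c • x) a = c • smulA x a
  smul_smulA : ∀ (c : ℂ) x a, smulA x (c • a) = c • smulA x a
  inner_add_right : ∀ x y z, inner x (y + z) = inner x y + inner x z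
  inner_smulA_right : ∀ x y a, inner x (smulA y a) = inner x y * a
  inner_smul_right : ∀ (c : ℂ) x y, inner x (c • y) = c • inner x y
  inner_conj : ∀ x y, star (inner x y) = inner y x
  inner_self_nonneg : ∀ x, 0 ≤ inner x x
  inner_self_eq_zero : ∀ x, inner x x = 0 → x = 0
  norm_eq : ∀ x, ‖x‖ = Real.sqrt ‖inner x x‖

/-- `π` is a representation of `A` by adjointable operators on the Hilbert
`A`-module `X`. -/
def IsRepOn {A X : Type*} [CStarAlgebra A] [PartialOrder A] [StarOrderedRing A]
    [NormedAddCommGroup X] [NormedSpace ℂ X] (hX : HilbMod A X) (π : A → X →L[ℂ] X) : Prop :=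
  π 1 = ContinuousLinearMap.id ℂ X ∧
  (∀ a b x, π (a * b) x = π a (π b x)) ∧
  (∀ a b, π (a + b) = π a + π b) ∧
  (∀ (c : ℂ) a, π (c • a) = c • π a) ∧
  (∀ a x y, hX.inner (π a x) y = hX.inner x (π (star a) y)) ∧
  ∀ a x b, π a (hX.smulA x b) = hX.smulA (π a x) b

/-- An equivariant representation `(ρ, v)` of `Σ` on a Hilbert `A`-module `X`. -/
structure EquivRep {A G : Type*} [CStarAlgebra A] [PartialOrder A] [StarOrderedRing A]
    [Group G] (S : TwistedSystem A G) {X : Type*} [NormedAddCommGroup X] [NormedSpace ℂ X]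
    (hX : HilbMod A X) where
  ρ : A → X →L[ℂ] X
  ρ_rep : IsRepOn hX ρ
  v : G → X ≃L[ℂ] X
  cov : ∀ g a x, ρ (S.α g a) x = v g (ρ a ((v g).symm x))
  v_mul : ∀ g h x, v g (v h x) = hX.smulA (ρ (S.σ g h) (v (g * h) x)) (star (S.σ g h))
  v_inner : ∀ g x y, S.α g (hX.inner x y) = hX.inner (v g x) (v g y)
  v_smulA : ∀ g x a, v g (hX.smulA x a) = hX.smulA (v g x) (S.α g a)

/-- The data of the quotient system `Σ̃ = (A/J, G, α̃, σ̃)`, its reduced crossed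
product, and the canonical map `q̃ : C*_r(Σ) → C*_r(Σ̃)`. -/
structure QuotientData {A G : Type*} [CStarAlgebra A] [Group G] {S : TwistedSystem A G}
    {B : Type*} [CStarAlgebra B] (D : CrossedProduct S B) (J : Set A) where
  Aq : Type
  [algAq : CStarAlgebra Aq]
  Sq : @TwistedSystem Aq G algAq _
  Bq : Type
  [algBq : CStarAlgebra Bq]
  Dq : @CrossedProduct Aq G algAq _ Sq Bq algBq
  q : A → Aq
  q_add : ∀ a b, q (a + b) = q a + q b
  q_mul : ∀ a b, q (a * b) = q a * q b
  q_star : ∀ a, q (star a) = star (q a)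
  q_smul : ∀ (c : ℂ) a, q (c • a) = c • q a
  q_one : q 1 = 1
  q_surj : Function.Surjective q
  q_ker : ∀ a, q a = 0 ↔ a ∈ J
  q_alpha : ∀ g a, q (S.α g a) = Sq.α g (q a)
  q_sigma : ∀ g h, q (S.σ g h) = Sq.σ g h
  Q : B → Bq
  Q_add : ∀ x y, Q (x + y) = Q x + Q y
  Q_smul : ∀ (c : ℂ) x, Q (c • x) = c • Q x
  Q_mul : ∀ x y, Q (x * y) = Q x * Q y
  Q_star : ∀ x, Q (star x) = star (Q x)
  Q_cont : Continuous Q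
  Q_gen : ∀ a g, Q (D.ι a * D.u g) = Dq.ι (q a) * Dq.u g

attribute [instance] QuotientData.algAq QuotientData.algBq

/-- The data of the reduced group C*-algebra `C*_r(G)`, the minimal tensor
product `C*_r(Σ) ⊗ C*_r(G)` and the reduced dual coaction
`δ_Σ : C*_r(Σ) → C*_r(Σ) ⊗ C*_r(G)`, `δ_Σ(a λ_Σ(g)) = a λ_Σ(g) ⊗ λ(g)`,
together with the slice map `id ⊗ τ` satisfying `(id ⊗ τ) ∘ δ_Σ = E`. -/
structure CoactionData {A G : Type*} [CStarAlgebra A] [Group G] {S : TwistedSystem A G}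
    {B : Type*} [CStarAlgebra B] (D : CrossedProduct S B) where
  CG : Type
  [algCG : CStarAlgebra CG]
  lam : G → CG
  lam_unitary : ∀ g, lam g ∈ unitary CG
  lam_mul : ∀ g h, lam (g * h) = lam g * lam h
  lam_gen : Dense (↑(Submodule.span ℂ (Set.range lam)) : Set CG)
  tau : CG →L[ℂ] ℂ
  tau_pos : ∀ c, 0 ≤ tau (star c * c)
  tau_lam_one : tau (lam 1) = 1
  tau_lam_ne : ∀ g, g ≠ 1 → tau (lam g) = 0
  BT : Type
  [algBT : CStarAlgebra BT]
  tens : B → CG → BT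
  tens_add_left : ∀ x y c, tens (x + y) c = tens x c + tens y c
  tens_add_right : ∀ x c d, tens x (c + d) = tens x c + tens x d
  tens_smul_left : ∀ (z : ℂ) x c, tens (z • x) c = z • tens x c
  tens_smul_right : ∀ (z : ℂ) x c, tens x (z • c) = z • tens x c
  tens_mul : ∀ x y c d, tens x c * tens y d = tens (x * y) (c * d)
  tens_star : ∀ x c, star (tens x c) = tens (star x) (star c)
  tens_norm : ∀ x c, ‖tens x c‖ = ‖x‖ * ‖c‖
  tens_gen : Dense (↑(Submodule.span ℂ {z : BT | ∃ x c, z = tens x c}) : Set BT)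
  slice : BT →L[ℂ] B
  slice_tens : ∀ x c, slice (tens x c) = tau c • x
  delta : B → BT
  delta_add : ∀ x y, delta (x + y) = delta x + delta y
  delta_smul : ∀ (z : ℂ) x, delta (z • x) = z • delta x
  delta_mul : ∀ x y, delta (x * y) = delta x * delta y
  delta_star : ∀ x, delta (star x) = star (delta x)
  delta_cont : Continuous delta
  delta_gen : ∀ a g, delta (D.ι a * D.u g) = tens (D.ι a * D.u g) (lam g)
  slice_delta : ∀ x, slice (delta x) = D.ι (D.E x)

attribute [instance] CoactionData.algCG CoactionData.algBT


namespace IsClosedIdeal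

/-- A closed two-sided ideal, as a complex subspace. -/
def toSubmodule {I : Set B} (hI : IsClosedIdeal I) : Submodule ℂ B where
  carrier := I
  zero_mem' := hI.2.1
  add_mem' hx hy := hI.2.2.1 _ _ hx hy
  smul_mem' c x hx := by
    have h := (hI.2.2.2 x hx (c • 1)).1
    rwa [smul_mul_assoc, one_mul] at h

theorem isClosed_toSubmodule {I : Set B} (hI : IsClosedIdeal I) :
    IsClosed (hI.toSubmodule : Set B) := hI.1

end IsClosedIdeal

theorem IsInvIdeal.isClosedIdeal {J : Set A} (hJ : IsInvIdeal S J) : IsClosedIdeal J :=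
  ⟨hJ.1, hJ.2.1, hJ.2.2.1, hJ.2.2.2.1⟩

/-- A continuous linear map sending a set `s` into a closed subspace sends the closed linear
span of `s` into it. -/
theorem map_mem_of_mem_closure_span {E F : Type*} [NormedAddCommGroup E] [NormedSpace ℂ E]
    [NormedAddCommGroup F] [NormedSpace ℂ F] {s : Set E} {P : Submodule ℂ F}
    (hP : IsClosed (P : Set F)) (f : E →L[ℂ] F) (h : ∀ x ∈ s, f x ∈ P) {x : E}
    (hx : x ∈ closure (Submodule.span ℂ s : Set E)) : f x ∈ P := by
  have hspan : Submodule.span ℂ s ≤ P.comap (f : E →ₗ[ℂ] F) := Submodule.span_le.2 h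
  exact closure_minimal (t := f ⁻¹' (P : Set F)) hspan (hP.preimage f.continuous) hx

/-- The closed span of a set which absorbs multiplication by a set with dense span is a
closed two-sided ideal. -/
theorem isClosedIdeal_closure_span {s t : Set B} (ht : Dense (Submodule.span ℂ t : Set B))
    (h : ∀ x ∈ s, ∀ b ∈ t, b * x ∈ s ∧ x * b ∈ s) :
    IsClosedIdeal (closure (Submodule.span ℂ s : Set B)) := by
  let P := (Submodule.span ℂ s).topologicalClosure
  have hP : IsClosed (P : Set B) := Submodule.isClosed_topologicalClosure _
  have hsP : ∀ x ∈ s, x ∈ P := fun x hx => subset_closure (Submodule.subset_span hx)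
  refine ⟨isClosed_closure, P.zero_mem, fun x y hx hy => P.add_mem hx hy, fun x hx b => ⟨?_, ?_⟩⟩
  · refine map_mem_of_mem_closure_span (P := P) hP (ContinuousLinearMap.mul ℂ B b)
      (fun x hx => ?_) hx
    exact map_mem_of_mem_closure_span hP ((ContinuousLinearMap.mul ℂ B).flip x)
      (fun c hc => hsP _ (h x hx c hc).1) (ht b)
  · refine map_mem_of_mem_closure_span (P := P) hP ((ContinuousLinearMap.mul ℂ B).flip b)
      (fun x hx => ?_) hx
    exact map_mem_of_mem_closure_span hP (ContinuousLinearMap.mul ℂ B x)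
      (fun c hc => hsP _ (h x hx c hc).2) (ht b)

theorem dense_span_univ : Dense (Submodule.span ℂ (Set.univ : Set B) : Set B) := by
  simp

section genIdeal

variable (D : CrossedProduct S B) {J : Set A}

theorem isClosedIdeal_genIdeal (J : Set A) : IsClosedIdeal (genIdeal D J) := by
  refine isClosedIdeal_closure_span dense_span_univ ?_
  rintro _ ⟨x, y, j, hj, rfl⟩ b -
  exact ⟨⟨b * x, y, j, hj, by simp only [mul_assoc]⟩, ⟨x, y * b, j, hj, by simp only [mul_assoc]⟩⟩

theorem iota_mem_genIdeal {j : A} (hj : j ∈ J) : D.ι j ∈ genIdeal D J :=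
  subset_closure (Submodule.subset_span ⟨1, 1, j, hj, by simp⟩)

theorem genIdeal_subset {I : Set B} (hI : IsClosedIdeal I) (h : ∀ j ∈ J, D.ι j ∈ I) :
    genIdeal D J ⊆ I := by
  intro x hx
  refine map_mem_of_mem_closure_span hI.isClosed_toSubmodule (ContinuousLinearMap.id ℂ B) ?_ hx
  rintro _ ⟨x, y, j, hj, rfl⟩
  exact (hI.2.2.2 _ (hI.2.2.2 _ (h j hj) x).1 y).2

end genIdeal

namespace CrossedProduct

variable (D : CrossedProduct S B)

theorem u_mul_star_u (g : G) : D.u g * star (D.u g) = 1 :=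
  Unitary.mul_star_self_of_mem (D.u_unitary g)

theorem u_mul_star (g h : G) :
    D.u g * star (D.u h) = D.ι (star (S.σ (g * h⁻¹) h)) * D.u (g * h⁻¹) := by
  have hm := D.u_mul (g * h⁻¹) h
  rw [inv_mul_cancel_right] at hm
  have hg : D.u g = D.ι (star (S.σ (g * h⁻¹) h)) * (D.u (g * h⁻¹) * D.u h) := by
    rw [hm, ← mul_assoc, ← map_mul, Unitary.star_mul_self_of_mem (S.σ_unitary _ _), map_one,
      one_mul]
  rw [hg, mul_assoc, mul_assoc, D.u_mul_star_u, mul_one]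

theorem hatF_generator_self (a : A) (g : G) : hatF D (D.ι a * D.u g) g = a := by
  rw [hatF, mul_assoc, D.u_mul_star_u, mul_one, D.E_iota]

theorem hatF_generator_of_ne (a : A) {g h : G} (hgh : g ≠ h) :
    hatF D (D.ι a * D.u g) h = 0 := by
  rw [hatF, mul_assoc, D.u_mul_star, ← mul_assoc, ← map_mul]
  exact D.E_perp _ _ fun hc => hgh (mul_inv_eq_one.1 hc)

/-- The Fourier coefficient at `g`, as a continuous linear map. -/
def coeff (g : G) : B →L[ℂ] A := D.E.comp ((ContinuousLinearMap.mul ℂ B).flip (star (D.u g)))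

theorem coeff_apply (g : G) (x : B) : D.coeff g x = hatF D x g := rfl

theorem eq_of_eq_on_generators {F : Type*} [NormedAddCommGroup F] [NormedSpace ℂ F]
    {f f' : B →L[ℂ] F} (h : ∀ a g, f (D.ι a * D.u g) = f' (D.ι a * D.u g)) : f = f' := by
  refine ContinuousLinearMap.ext_on D.generated ?_
  rintro _ ⟨a, g, rfl⟩
  exact h a g

theorem E_iota_mul (a : A) (x : B) : D.E (D.ι a * x) = a * D.E x := by
  have h : D.E.comp (ContinuousLinearMap.mul ℂ B (D.ι a)) =
      (ContinuousLinearMap.mul ℂ A a).comp D.E := by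
    refine D.eq_of_eq_on_generators fun b g => ?_
    simp only [ContinuousLinearMap.comp_apply, ContinuousLinearMap.mul_apply']
    rw [← mul_assoc, ← map_mul]
    by_cases hg : g = 1
    · rw [hg, D.u_one, mul_one, mul_one, D.E_iota, D.E_iota]
    · rw [D.E_perp _ _ hg, D.E_perp _ _ hg, mul_zero]
  exact DFunLike.congr_fun h x

theorem eq_zero_of_hatF_eq_zero {x : B} (h : ∀ g, hatF D x g = 0) : x = 0 := by
  refine D.E_faithful x ?_
  have h' : (fun g => D.E (x * star (D.u g))) = fun _ => 0 := funext h
  rw [D.E_inner, h']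
  simp [innerAS]

/-- An unconditionally convergent Fourier series converges to the element it comes from. -/
theorem hasSum_of_CFmem {x : B} (hx : CFmem D x) :
    HasSum (fun g => D.ι (hatF D x g) * D.u g) x := by
  obtain ⟨y, hy⟩ := hx
  have hyx : y - x = 0 := by
    refine D.eq_zero_of_hatF_eq_zero fun g => ?_
    have h := (D.coeff g).hasSum hy
    have h' : HasSum (fun k => D.coeff g (D.ι (hatF D x k) * D.u k)) (hatF D x g) := by
      have hs := hasSum_single (f := fun k => D.coeff g (D.ι (hatF D x k) * D.u k)) g
        fun k hk => D.hatF_generator_of_ne (hatF D x k) hk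
      rwa [D.coeff_apply, D.hatF_generator_self] at hs
    rw [← D.coeff_apply, map_sub, h.unique h', D.coeff_apply, sub_self]
  rwa [sub_eq_zero.1 hyx] at hy

/-- The inclusion of `A`, as a continuous linear map. -/
def iotaCLM : A →L[ℂ] B where
  toFun := D.ι
  map_add' := map_add D.ι
  map_smul' := map_smul D.ι
  cont := (AddMonoidHomClass.isometry_of_norm D.ι D.ι_isometric).continuous

theorem iotaCLM_apply (a : A) : D.iotaCLM a = D.ι a := rfl

theorem hatF_of_isMultiplier {T : G → A → A} {M : B →L[ℂ] B} (hM : IsMultiplier D T M)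
    (x : B) (g : G) : hatF D (M x) g = T g (hatF D x g) := by
  have h : (D.coeff g).comp M = (D.coeff g).comp (M.comp
      (((ContinuousLinearMap.mul ℂ B).flip (D.u g)).comp (D.iotaCLM.comp (D.coeff g)))) := by
    refine D.eq_of_eq_on_generators fun a k => ?_
    simp only [ContinuousLinearMap.comp_apply, ContinuousLinearMap.flip_apply,
      ContinuousLinearMap.mul_apply', iotaCLM_apply, coeff_apply]
    by_cases hk : k = g
    · rw [hk, D.hatF_generator_self]
    · rw [D.hatF_generator_of_ne a hk, map_zero, zero_mul, map_zero, hM.2,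
        D.hatF_generator_of_ne _ hk, ← D.coeff_apply, map_zero]
  calc hatF D (M x) g = hatF D (M (D.ι (hatF D x g) * D.u g)) g := DFunLike.congr_fun h x
    _ = T g (hatF D x g) := by rw [hM.2, D.hatF_generator_self]

/-- The conditional expectation maps the ideal induced by `J` back into `J`. -/
theorem E_mem_of_mem_genIdeal {J : Set A} (hJ : IsInvIdeal S J) {x : B}
    (hx : x ∈ genIdeal D J) : D.E x ∈ J := by
  have hP := hJ.isClosedIdeal.isClosed_toSubmodule
  refine map_mem_of_mem_closure_span hP D.E ?_ hx
  rintro _ ⟨x, y, j, hj, rfl⟩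
  rw [mul_assoc]
  refine map_mem_of_mem_closure_span hP
    (D.E.comp ((ContinuousLinearMap.mul ℂ B).flip (D.ι j * y))) ?_ (D.generated x)
  rintro _ ⟨a, g, rfl⟩
  change D.E (D.ι a * D.u g * (D.ι j * y)) ∈ J
  rw [← mul_assoc]
  refine map_mem_of_mem_closure_span hP
    (D.E.comp (ContinuousLinearMap.mul ℂ B (D.ι a * D.u g * D.ι j))) ?_ (D.generated y)
  rintro _ ⟨b, k, rfl⟩
  have hprod : D.ι a * D.u g * D.ι j * (D.ι b * D.u k) =
      D.ι (a * S.α g (j * b)) * (D.u g * D.u k) := by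
    calc D.ι a * D.u g * D.ι j * (D.ι b * D.u k)
        = D.ι a * (D.u g * D.ι (j * b)) * D.u k := by simp only [map_mul, mul_assoc]
      _ = D.ι (a * S.α g (j * b)) * (D.u g * D.u k) := by
        rw [D.covariance, map_mul D.ι a]
        simp only [mul_assoc]
  change D.E (D.ι a * D.u g * D.ι j * (D.ι b * D.u k)) ∈ J
  rw [hprod, D.E_iota_mul]
  exact (hJ.2.2.2.1 _ (hJ.2.2.2.1 _ (hJ.2.2.2.2 g _ (hJ.2.2.2.1 j hj b).2) a).1 _).2

/-- Induced ideals are invariant under the dual coaction. -/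
theorem delta_mem_of_mem_genIdeal (cd : CoactionData D) {J : Set A} {x : B}
    (hx : x ∈ genIdeal D J) :
    cd.delta x ∈ closure (Submodule.span ℂ
      {z : cd.BT | ∃ j ∈ genIdeal D J, ∃ c, z = cd.tens j c} : Set cd.BT) := by
  have hI := isClosedIdeal_genIdeal D J
  have hK : IsClosedIdeal (closure (Submodule.span ℂ
      {z : cd.BT | ∃ j ∈ genIdeal D J, ∃ c, z = cd.tens j c} : Set cd.BT)) := by
    refine isClosedIdeal_closure_span cd.tens_gen ?_
    rintro _ ⟨j, hj, c, rfl⟩ _ ⟨b, d, rfl⟩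
    exact ⟨⟨b * j, (hI.2.2.2 j hj b).1, d * c, cd.tens_mul _ _ _ _⟩,
      ⟨j * b, (hI.2.2.2 j hj b).2, c * d, cd.tens_mul _ _ _ _⟩⟩
  let δ : B →L[ℂ] cd.BT :=
    { toFun := cd.delta
      map_add' := cd.delta_add
      map_smul' := cd.delta_smul
      cont := cd.delta_cont }
  refine map_mem_of_mem_closure_span hK.isClosed_toSubmodule δ ?_ hx
  rintro _ ⟨x, y, j, hj, rfl⟩
  change cd.delta (x * D.ι j * y) ∈ closure _
  have hj' : cd.delta (D.ι j) = cd.tens (D.ι j) (cd.lam 1) := by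
    simpa [D.u_one] using cd.delta_gen j 1
  rw [cd.delta_mul, cd.delta_mul, hj']
  refine (hK.2.2.2 _ (hK.2.2.2 _ (subset_closure (Submodule.subset_span ?_)) _).1 _).2
  exact ⟨_, iota_mem_genIdeal D hj, _, rfl⟩

theorem eInv_of_delta_mem (cd : CoactionData D) {I : Set B} (hI : IsClosedIdeal I)
    (h : ∀ x ∈ I, cd.delta x ∈ closure (Submodule.span ℂ
      {z : cd.BT | ∃ j ∈ I, ∃ c, z = cd.tens j c} : Set cd.BT)) : EInv D I := by
  intro x hx
  rw [← cd.slice_delta]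
  refine map_mem_of_mem_closure_span hI.isClosed_toSubmodule cd.slice ?_ (h x hx)
  rintro _ ⟨j, hj, c, rfl⟩
  rw [cd.slice_tens]
  exact hI.toSubmodule.smul_mem _ hj

theorem eInv_genIdeal {J : Set A} (hJ : IsInvIdeal S J) : EInv D (genIdeal D J) :=
  fun _ hx => iota_mem_genIdeal D (D.E_mem_of_mem_genIdeal hJ hx)

theorem iota_mem_genIdeal_iff {J : Set A} (hJ : IsInvIdeal S J) {a : A} :
    D.ι a ∈ genIdeal D J ↔ a ∈ J :=
  ⟨fun h => D.E_iota a ▸ D.E_mem_of_mem_genIdeal hJ h, iota_mem_genIdeal D⟩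

/-- The intersection of an ideal of the crossed product with `A` is an invariant ideal. -/
theorem isInvIdeal_preimage {I : Set B} (hI : IsClosedIdeal I) : IsInvIdeal S (D.ι ⁻¹' I) := by
  refine ⟨hI.1.preimage D.iotaCLM.continuous, ?_, fun a b ha hb => ?_, fun a ha b => ⟨?_, ?_⟩,
    fun g a ha => ?_⟩
  · simpa using hI.2.1
  · simpa using hI.2.2.1 _ _ ha hb
  · simpa using (hI.2.2.2 _ ha (D.ι b)).1
  · simpa using (hI.2.2.2 _ ha (D.ι b)).2
  · have h := (hI.2.2.2 _ (hI.2.2.2 _ ha (D.u g)).1 (star (D.u g))).2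
    rwa [D.covariance, mul_assoc, D.u_mul_star_u, mul_one] at h

/-- Given a Fourier summing net preserving the invariant ideals of `A`, an `E`-invariant ideal is
induced by its intersection with `A`. -/
theorem genIdeal_preimage_eq (net : FSNet D)
    (hnet : ∀ J : Set A, IsInvIdeal S J → ∀ i g, ∀ a ∈ J, net.T i g a ∈ J)
    {I : Set B} (hI : IsClosedIdeal I) (hE : EInv D I) : genIdeal D (D.ι ⁻¹' I) = I := by
  refine (genIdeal_subset D hI fun j hj => hj).antisymm fun x hx => ?_
  have hJ := D.isInvIdeal_preimage hI
  have hK := isClosedIdeal_genIdeal D (D.ι ⁻¹' I)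
  have hM : ∀ i, net.M i x ∈ genIdeal D (D.ι ⁻¹' I) := fun i => by
    refine hK.1.mem_of_tendsto (D.hasSum_of_CFmem (net.M_cf i x)) (.of_forall fun s => ?_)
    refine hK.toSubmodule.sum_mem fun g _ => ?_
    refine (hK.2.2.2 _ (iota_mem_genIdeal D ?_) (D.u g)).2
    rw [D.hatF_of_isMultiplier ⟨net.T_lin i, net.M_mult i⟩]
    exact hnet _ hJ i g _ (hE _ (hI.2.2.2 x hx _).2)
  let := net.pre
  have := net.dir
  have := net.nonempty
  exact hK.1.mem_of_tendsto (tendsto_iff_norm_sub_tendsto_zero.2 (net.M_lim x)) (.of_forall hM)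

end CrossedProduct

/-- Proposition `bij`. If there is a Fourier summing net for
`Σ` preserving the invariant ideals of `A`, then an ideal of `C*_r(Σ)` is
`E`-invariant iff it is `δ_Σ`-invariant iff it is induced; consequently
`J ↦ ⟨J⟩` is a bijection from the invariant ideals of `A` onto the
`E`-invariant ideals of `C*_r(Σ)`. -/
theorem statement13 {A G B : Type*} [CStarAlgebra A] [Group G] [CStarAlgebra B]
    (S : TwistedSystem A G) (D : CrossedProduct S B) (cd : CoactionData D)
    (hnet : ∃ net : FSNet D,
      ∀ J : Set A, IsInvIdeal S J → ∀ i g, ∀ a ∈ J, net.T i g a ∈ J) :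
    (∀ I : Set B, IsClosedIdeal I →
      ((EInv D I ↔ ∀ x ∈ I, cd.delta x ∈
          closure (↑(Submodule.span ℂ {z : cd.BT | ∃ j ∈ I, ∃ c, z = cd.tens j c})
            : Set cd.BT)) ∧
        (EInv D I ↔ ∃ J : Set A, IsInvIdeal S J ∧ I = genIdeal D J))) ∧
    Set.BijOn (genIdeal D) {J : Set A | IsInvIdeal S J}
      {I : Set B | IsClosedIdeal I ∧ EInv D I} := by
  obtain ⟨net, hnet⟩ := hnet
  refine ⟨fun I hI => ⟨⟨fun hE => ?_, D.eInv_of_delta_mem cd hI⟩, fun hE => ?_, ?_⟩, ?_, ?_, ?_⟩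
  · rw [← D.genIdeal_preimage_eq net hnet hI hE]
    exact fun x hx => D.delta_mem_of_mem_genIdeal cd hx
  · exact ⟨_, D.isInvIdeal_preimage hI, (D.genIdeal_preimage_eq net hnet hI hE).symm⟩
  · rintro ⟨J, hJ, rfl⟩
    exact D.eInv_genIdeal hJ
  · exact fun J hJ => ⟨isClosedIdeal_genIdeal D J, D.eInv_genIdeal hJ⟩
  · intro J hJ K hK h
    ext a
    rw [← D.iota_mem_genIdeal_iff hJ, h, D.iota_mem_genIdeal_iff hK]
  · exact fun I ⟨hI, hE⟩ => ⟨_, D.isInvIdeal_preimage hI, D.genIdeal_preimage_eq net hnet hI hE⟩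

end BCFourier
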